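/- Let Q be a rational indefinite nondegenerate quadratic form on ℝⁿ with Γ=SO⁺_Q(ℤ) a lattice in G=SO⁺_Q(ℝ). Let {A_t}_{t>0} be a family of shrinking targets in 𝕋ⁿ, let Ã_t⊆[0,1]ⁿ be sets whose projection to 𝕋ⁿ equals A_t, let F⊂G be a fixed fundamental domain for G/Γ containing the identity, fix a constant c>1, set B̃_t={(g,α)∈G̃ : g∈F, ‖g‖≤c, α∈Ã_t}, and let B_t⊆G̃/Γ̃ be the projection of B̃_t. If for m_{G̃}-almost every x∈G̃/Γ̃ there is t₀ such that for all t≥t₀ there exists g∈G_t with g⁻¹x∈B_t, then for Lebesgue-almost every α∈𝕋ⁿ there is t₀ such that for all t≥t₀ there exists γ∈Γ with ‖γ‖≤c²t and αγ∈A_t. -/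

import Mathlib

open MeasureTheory Matrix Filter
open scoped ENNReal Real

noncomputable section

instance {n : ℕ} : MeasurableSpace (Matrix (Fin n) (Fin n) ℝ) :=
  inferInstanceAs (MeasurableSpace (Fin n → Fin n → ℝ))

/-- The Euclidean norm of a vector in `ℝⁿ`. -/
def eunorm {n : ℕ} (v : Fin n → ℝ) : ℝ := Real.sqrt (∑ i, v i ^ 2)

/-- The operator norm of a matrix acting on Euclidean `ℝⁿ`. -/
def opNorm {n : ℕ} (g : Matrix (Fin n) (Fin n) ℝ) : ℝ :=
  ‖LinearMap.toContinuousLinearMap (Matrix.toEuclideanLin g)‖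

/-- The norm `‖g‖ := ‖g⁻¹‖_op` used for norm balls. -/
def mnorm {n : ℕ} (g : Matrix (Fin n) (Fin n) ℝ) : ℝ := opNorm g⁻¹

/-- `Q` is a nondegenerate quadratic form, represented by an invertible symmetric matrix. -/
def IsNondegQuadForm {n : ℕ} (Q : (Fin n → ℝ) → ℝ) : Prop :=
  ∃ J : Matrix (Fin n) (Fin n) ℝ, J.IsSymm ∧ IsUnit J.det ∧ ∀ v, Q v = v ⬝ᵥ J.mulVec v

/-- `Q` is proportional to a quadratic form with rational coefficients. -/
def IsRationalForm {n : ℕ} (Q : (Fin n → ℝ) → ℝ) : Prop :=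
  ∃ c : ℝ, c ≠ 0 ∧ ∃ J : Matrix (Fin n) (Fin n) ℚ,
    ∀ v, Q v = c * (v ⬝ᵥ (J.map (fun r => (r : ℝ))).mulVec v)

/-- `Q` has signature `(p,q)`: it is `GL_n(ℝ)`-equivalent to `v₁²+⋯+v_p²−v_{p+1}²−⋯−v_n²`. -/
def HasSignature {n : ℕ} (Q : (Fin n → ℝ) → ℝ) (p q : ℕ) : Prop :=
  p + q = n ∧ ∃ g : Matrix (Fin n) (Fin n) ℝ, IsUnit g.det ∧
    ∀ v, Q (vecMul v g) = ∑ i : Fin n, (if (i : ℕ) < p then (v i) ^ 2 else -((v i) ^ 2))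

/-- The special orthogonal group of `Q` (acting on row vectors). -/
def SOset {n : ℕ} (Q : (Fin n → ℝ) → ℝ) : Set (Matrix (Fin n) (Fin n) ℝ) :=
  {g | g.det = 1 ∧ ∀ v, Q (vecMul v g) = Q v}

/-- `SO⁺_Q(ℝ)`: the connected component of the identity in `SO_Q(ℝ)`. -/
def SOplus {n : ℕ} (Q : (Fin n → ℝ) → ℝ) : Set (Matrix (Fin n) (Fin n) ℝ) :=
  connectedComponentIn (SOset Q) 1

/-- `Γ = SO⁺_Q(ℤ) = SO⁺_Q(ℝ) ∩ SL_n(ℤ)`. -/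
def SOZ {n : ℕ} (Q : (Fin n → ℝ) → ℝ) : Set (Matrix (Fin n) (Fin n) ℝ) :=
  SOplus Q ∩ {g | ∀ i j, ∃ z : ℤ, g i j = (z : ℝ)}

/-- The norm ball `G_t = {g ∈ G : ‖g⁻¹‖_op ≤ t}` in `G = SO⁺_Q(ℝ)`. -/
def GballQ {n : ℕ} (Q : (Fin n → ℝ) → ℝ) (t : ℝ) : Set (Matrix (Fin n) (Fin n) ℝ) :=
  SOplus Q ∩ {g | mnorm g ≤ t}

/-- `μ` is a (left) Haar measure for the subgroup `G` of matrices: it is supported on `G`,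
left-invariant under `G`, positive on open sets meeting `G` and finite on compact sets. -/
structure IsHaarOn {n : ℕ} (G : Set (Matrix (Fin n) (Fin n) ℝ))
    (μ : Measure (Matrix (Fin n) (Fin n) ℝ)) : Prop where
  compl : μ Gᶜ = 0
  left_inv : ∀ g ∈ G, ∀ s : Set (Matrix (Fin n) (Fin n) ℝ),
    MeasurableSet s → μ ((g * ·) ⁻¹' s) = μ s
  open_pos : ∀ U : Set (Matrix (Fin n) (Fin n) ℝ), IsOpen U → (U ∩ G).Nonempty → 0 < μ U
  compact_fin : ∀ K : Set (Matrix (Fin n) (Fin n) ℝ), IsCompact K → μ K < ⊤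

/-- Multiplication in `G̃ = G ⋉ ℝⁿ` (row-vector convention): `(h,α)(g,v) = (hg, αg+v)`. -/
def tmul {n : ℕ} (x y : Matrix (Fin n) (Fin n) ℝ × (Fin n → ℝ)) :
    Matrix (Fin n) (Fin n) ℝ × (Fin n → ℝ) :=
  (x.1 * y.1, vecMul x.2 y.1 + y.2)

/-- The orbit relation of the right action of `Γ̃ = Γ ⋉ ℤⁿ` on `G̃`. -/
def latRel {n : ℕ} (Γ : Set (Matrix (Fin n) (Fin n) ℝ))
    (x y : Matrix (Fin n) (Fin n) ℝ × (Fin n → ℝ)) : Prop :=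
  ∃ γ ∈ Γ, ∃ u : Fin n → ℤ, y = tmul x (γ, fun i => (u i : ℝ))

/-- The quotient `G̃/Γ̃` (as a quotient of the ambient `Mat_n(ℝ) × ℝⁿ`). -/
def XQuot (n : ℕ) (Γ : Set (Matrix (Fin n) (Fin n) ℝ)) : Type :=
  Quot (latRel Γ)

instance (n : ℕ) (Γ : Set (Matrix (Fin n) (Fin n) ℝ)) : TopologicalSpace (XQuot n Γ) :=
  inferInstanceAs (TopologicalSpace (Quot _))

instance (n : ℕ) (Γ : Set (Matrix (Fin n) (Fin n) ℝ)) : MeasurableSpace (XQuot n Γ) := borel _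

/-- The left action of `(g,w) ∈ G̃` on `G̃/Γ̃`. -/
def actTG {n : ℕ} {Γ : Set (Matrix (Fin n) (Fin n) ℝ)} (g : Matrix (Fin n) (Fin n) ℝ)
    (w : Fin n → ℝ) : XQuot n Γ → XQuot n Γ :=
  Quot.map (fun x => (g * x.1, vecMul w x.1 + x.2)) (by
    rintro x y ⟨γ, hγ, u, rfl⟩
    refine ⟨γ, hγ, u, ?_⟩
    simp only [tmul, Prod.mk.injEq]
    constructor
    · rw [Matrix.mul_assoc]
    · rw [Matrix.add_vecMul, Matrix.vecMul_vecMul, add_assoc])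

/-- The left action of `g ∈ G` on `G̃/Γ̃`. -/
def actG {n : ℕ} {Γ : Set (Matrix (Fin n) (Fin n) ℝ)} (g : Matrix (Fin n) (Fin n) ℝ) :
    XQuot n Γ → XQuot n Γ := actTG g 0

/-- The averaging operator `β_S f (x) = (1/μ_G(S)) ∫_S f(g⁻¹x) dμ_G(g)`. -/
def avgOp {n : ℕ} {Γ : Set (Matrix (Fin n) (Fin n) ℝ)}
    (μG : Measure (Matrix (Fin n) (Fin n) ℝ)) (S : Set (Matrix (Fin n) (Fin n) ℝ))
    (f : XQuot n Γ → ℂ) (x : XQuot n Γ) : ℂ :=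
  (μG S).toReal⁻¹ • ∫ g in S, f (actG g⁻¹ x) ∂μG

/-- The unit cube `[0,1]ⁿ`, a fundamental domain for `ℝⁿ/ℤⁿ`. -/
def unitCube (n : ℕ) : Set (Fin n → ℝ) := Set.univ.pi fun _ => Set.Icc (0 : ℝ) 1

/-- Membership in `L²₀₀(G̃/Γ̃)`: the average of `f` over (almost) each fiber `ℝⁿ/ℤⁿ` vanishes. -/
def FiberAvgZero {n : ℕ} {Γ : Set (Matrix (Fin n) (Fin n) ℝ)}
    (μG : Measure (Matrix (Fin n) (Fin n) ℝ)) (f : XQuot n Γ → ℂ) : Prop :=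
  ∀ᵐ g ∂μG, ∫ w in unitCube n, f (Quot.mk (latRel Γ) (g, w)) = 0

/-- The exponent `κ₁` from Theorem 1.3 (property (T) cases). -/
def kappa1 (n : ℕ) : ℝ :=
  if n % 4 = 0 then 1 / n
  else if n % 4 = 1 then 1 / ((n : ℝ) - 1)
  else if n % 4 = 2 then 1 / ((n : ℝ) - 2)
  else 1 / ((n : ℝ) + 1)

/-- The exponent `κ₀` of Theorem 1.1, depending only on the signature `(p,q)`. -/
def kappa0 (p q : ℕ) : ℝ :=
  if q = 1 then 1
  else if (p, q) = (2, 2) then 2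
  else if (p, q) = (4, 2) ∨ (p, q) = (3, 3) then 3 / 2
  else if (p, q) = (6, 3) then 5 / 2
  else 2 * kappa1 (p + q) * q * ((p : ℝ) - 1)

/-- `F` is a (strict, set-theoretic) fundamental domain for `G/Γ` containing the identity. -/
def IsFundDom {n : ℕ} (G Γ F : Set (Matrix (Fin n) (Fin n) ℝ)) : Prop :=
  F ⊆ G ∧ (1 : Matrix (Fin n) (Fin n) ℝ) ∈ F ∧
  (∀ g ∈ G, ∃ γ ∈ Γ, g * γ ∈ F) ∧
  (∀ f₁ ∈ F, ∀ f₂ ∈ F, ∀ γ ∈ Γ, f₁ * γ = f₂ → γ = 1)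

/-- The shrinking targets `B_t ⊆ G̃/Γ̃`: projection of
`B̃_t = {(g,α) : g ∈ F, ‖g‖ ≤ c, α ∈ Ã_t}`. -/
def Bset {n : ℕ} (Γ : Set (Matrix (Fin n) (Fin n) ℝ)) (F : Set (Matrix (Fin n) (Fin n) ℝ))
    (c : ℝ) (Atil : ℝ → Set (Fin n → ℝ)) (t : ℝ) : Set (XQuot n Γ) :=
  {x | ∃ g : Matrix (Fin n) (Fin n) ℝ, ∃ α : Fin n → ℝ,
    g ∈ F ∧ mnorm g ≤ c ∧ α ∈ Atil t ∧ x = Quot.mk (latRel Γ) (g, α)}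

/-- The product of two elements of `SO_Q` lies in `SO_Q`. -/
theorem SOset_mul_mem {n : ℕ} {Q : (Fin n → ℝ) → ℝ} {a b : Matrix (Fin n) (Fin n) ℝ}
    (ha : a ∈ SOset Q) (hb : b ∈ SOset Q) : a * b ∈ SOset Q := by
  refine ⟨by rw [Matrix.det_mul, ha.1, hb.1, one_mul], fun v => ?_⟩
  rw [← Matrix.vecMul_vecMul, hb.2, ha.2]

theorem one_mem_SOset {n : ℕ} (Q : (Fin n → ℝ) → ℝ) : (1 : Matrix (Fin n) (Fin n) ℝ) ∈ SOset Q :=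
  ⟨Matrix.det_one, fun v => by rw [Matrix.vecMul_one]⟩

/-- The adjugate, which is the inverse, of an element of `SO_Q` lies in `SO_Q`. -/
theorem adjugate_mem_SOset {n : ℕ} {Q : (Fin n → ℝ) → ℝ} {a : Matrix (Fin n) (Fin n) ℝ}
    (ha : a ∈ SOset Q) : a.adjugate ∈ SOset Q := by
  refine ⟨by rw [Matrix.det_adjugate, ha.1, one_pow], fun v => ?_⟩
  rw [← ha.2, Matrix.vecMul_vecMul, Matrix.adjugate_mul, ha.1, one_smul, Matrix.vecMul_one]

theorem SOplus_subset_SOset {n : ℕ} (Q : (Fin n → ℝ) → ℝ) : SOplus Q ⊆ SOset Q :=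
  connectedComponentIn_subset _ _

theorem one_mem_SOplus {n : ℕ} (Q : (Fin n → ℝ) → ℝ) :
    (1 : Matrix (Fin n) (Fin n) ℝ) ∈ SOplus Q :=
  mem_connectedComponentIn (one_mem_SOset Q)

theorem SOplus_mul_mem {n : ℕ} {Q : (Fin n → ℝ) → ℝ} {a b : Matrix (Fin n) (Fin n) ℝ}
    (ha : a ∈ SOplus Q) (hb : b ∈ SOplus Q) : a * b ∈ SOplus Q := by
  have hconn : IsPreconnected ((a * ·) '' SOplus Q) :=
    isPreconnected_connectedComponentIn.image _ (by fun_prop)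
  have hsub : (a * ·) '' SOplus Q ⊆ SOset Q := by
    rintro _ ⟨x, hx, rfl⟩
    exact SOset_mul_mem (SOplus_subset_SOset Q ha) (SOplus_subset_SOset Q hx)
  have hle := hconn.subset_connectedComponentIn (x := a)
    ⟨1, one_mem_SOplus Q, mul_one a⟩ hsub
  have heq : connectedComponentIn (SOset Q) 1 = connectedComponentIn (SOset Q) a :=
    connectedComponentIn_eq ha
  rw [SOplus, heq]
  exact hle ⟨b, hb, rfl⟩

theorem nonsing_inv_eq_adjugate_of_det_eq_one {n : ℕ} {a : Matrix (Fin n) (Fin n) ℝ}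
    (ha : a.det = 1) : a⁻¹ = a.adjugate := by
  rw [Matrix.inv_def, ha, Ring.inverse_one, one_smul]

theorem SOplus_inv_mem {n : ℕ} {Q : (Fin n → ℝ) → ℝ} {a : Matrix (Fin n) (Fin n) ℝ}
    (ha : a ∈ SOplus Q) : a⁻¹ ∈ SOplus Q := by
  rw [nonsing_inv_eq_adjugate_of_det_eq_one (SOplus_subset_SOset Q ha).1]
  have hconn : IsPreconnected (Matrix.adjugate '' SOplus Q) :=
    isPreconnected_connectedComponentIn.image _
      (continuous_id.matrix_adjugate).continuousOn
  have hsub : Matrix.adjugate '' SOplus Q ⊆ SOset Q := by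
    rintro _ ⟨x, hx, rfl⟩
    exact adjugate_mem_SOset (SOplus_subset_SOset Q hx)
  exact hconn.subset_connectedComponentIn ⟨1, one_mem_SOplus Q, Matrix.adjugate_one⟩ hsub
    ⟨a, ha, rfl⟩

theorem one_mem_SOZ {n : ℕ} (Q : (Fin n → ℝ) → ℝ) : (1 : Matrix (Fin n) (Fin n) ℝ) ∈ SOZ Q :=
  ⟨one_mem_SOplus Q, fun i j => ⟨(1 : Matrix (Fin n) (Fin n) ℤ) i j, by
    by_cases h : i = j <;> simp [Matrix.one_apply, h]⟩⟩

theorem SOZ_mul_mem {n : ℕ} {Q : (Fin n → ℝ) → ℝ} {a b : Matrix (Fin n) (Fin n) ℝ}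
    (ha : a ∈ SOZ Q) (hb : b ∈ SOZ Q) : a * b ∈ SOZ Q := by
  refine ⟨SOplus_mul_mem ha.1 hb.1, fun i j => ?_⟩
  choose A hA using ha.2
  choose B hB using hb.2
  exact ⟨∑ k, A i k * B k j, by simp [Matrix.mul_apply, hA, hB]⟩

theorem SOZ_inv_mem {n : ℕ} {Q : (Fin n → ℝ) → ℝ} {a : Matrix (Fin n) (Fin n) ℝ}
    (ha : a ∈ SOZ Q) : a⁻¹ ∈ SOZ Q := by
  refine ⟨SOplus_inv_mem ha.1, fun i j => ?_⟩
  choose A hA using ha.2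
  have h : a = (Int.castRingHom ℝ).mapMatrix (Matrix.of A) := by
    ext i j
    simp [hA]
  refine ⟨(Matrix.of A).adjugate i j, ?_⟩
  rw [nonsing_inv_eq_adjugate_of_det_eq_one (SOplus_subset_SOset Q ha.1).1, h,
    ← RingHom.map_adjugate]
  simp

theorem isUnit_det_of_mem_SOplus {n : ℕ} {Q : (Fin n → ℝ) → ℝ} {a : Matrix (Fin n) (Fin n) ℝ}
    (ha : a ∈ SOplus Q) : IsUnit a.det := by
  rw [(SOplus_subset_SOset Q ha).1]
  exact isUnit_one

/-- An integral row vector times an element of `Γ` is integral. -/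
theorem exists_vecMul_SOZ_eq_intCast {n : ℕ} {Q : (Fin n → ℝ) → ℝ}
    {γ : Matrix (Fin n) (Fin n) ℝ} (hγ : γ ∈ SOZ Q) (u : Fin n → ℤ) :
    ∃ v : Fin n → ℤ, vecMul (fun i => (u i : ℝ)) γ = fun i => (v i : ℝ) := by
  choose A hA using hγ.2
  refine ⟨vecMul u (Matrix.of A), ?_⟩
  ext j
  simp [Matrix.vecMul, dotProduct, hA]

theorem latRel_equivalence {n : ℕ} (Q : (Fin n → ℝ) → ℝ) :
    Equivalence (latRel (SOZ Q)) where
  refl x := ⟨1, one_mem_SOZ Q, 0, by ext <;> simp [tmul]⟩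
  symm := by
    rintro x y ⟨γ, hγ, u, rfl⟩
    have hdet := isUnit_det_of_mem_SOplus hγ.1
    obtain ⟨v, hv⟩ := exists_vecMul_SOZ_eq_intCast (SOZ_inv_mem hγ) (-u)
    refine ⟨γ⁻¹, SOZ_inv_mem hγ, v, ?_⟩
    rw [← hv]
    refine Prod.ext ?_ ?_
    · simp [tmul, Matrix.mul_assoc, Matrix.mul_nonsing_inv _ hdet]
    · simp only [tmul]
      push_cast [Pi.neg_apply]
      change _ = _ + vecMul (-(fun i => (u i : ℝ))) γ⁻¹
      rw [Matrix.add_vecMul, Matrix.vecMul_vecMul, Matrix.mul_nonsing_inv _ hdet,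
        Matrix.vecMul_one, Matrix.neg_vecMul, add_neg_cancel_right]
  trans := by
    rintro x y z ⟨γ, hγ, u, rfl⟩ ⟨δ, hδ, w, rfl⟩
    obtain ⟨v, hv⟩ := exists_vecMul_SOZ_eq_intCast hδ u
    refine ⟨γ * δ, SOZ_mul_mem hγ hδ, v + w, ?_⟩
    refine Prod.ext ?_ ?_
    · simp [tmul, Matrix.mul_assoc]
    · simp only [tmul]
      rw [Matrix.add_vecMul, Matrix.vecMul_vecMul, hv, add_assoc]
      congr 1
      ext i
      simp

theorem mk_latRel_eq_iff {n : ℕ} {Q : (Fin n → ℝ) → ℝ}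
    {x y : Matrix (Fin n) (Fin n) ℝ × (Fin n → ℝ)} :
    Quot.mk (latRel (SOZ Q)) x = Quot.mk (latRel (SOZ Q)) y ↔ latRel (SOZ Q) x y :=
  (latRel_equivalence Q).quot_mk_eq_iff x y

instance {n : ℕ} (Γ : Set (Matrix (Fin n) (Fin n) ℝ)) : BorelSpace (XQuot n Γ) := ⟨rfl⟩

/-- The projection to the quotient, with the quotient type made explicit. -/
def toXQuot {n : ℕ} (Γ : Set (Matrix (Fin n) (Fin n) ℝ))
    (x : Matrix (Fin n) (Fin n) ℝ × (Fin n → ℝ)) : XQuot n Γ :=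
  Quot.mk _ x

theorem isOpenQuotientMap_toXQuot {n : ℕ} (Q : (Fin n → ℝ) → ℝ) :
    IsOpenQuotientMap (toXQuot (SOZ Q)) where
  surjective := Quot.mk_surjective
  continuous := continuous_quot_mk
  isOpenMap := by
    intro U hU
    have hpre : toXQuot (SOZ Q) ⁻¹' (toXQuot (SOZ Q) '' U) =
        ⋃ γ ∈ SOZ Q, ⋃ u : Fin n → ℤ, {x | tmul x (γ, fun i => (u i : ℝ)) ∈ U} := by
      ext x
      simp only [Set.mem_preimage, Set.mem_image, Set.mem_iUnion, Set.mem_ofPred_eq]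
      constructor
      · rintro ⟨y, hy, hyx⟩
        obtain ⟨γ, hγ, u, rfl⟩ := mk_latRel_eq_iff.1 hyx.symm
        exact ⟨γ, hγ, u, hy⟩
      · rintro ⟨γ, hγ, u, hx⟩
        exact ⟨_, hx, (mk_latRel_eq_iff.2 ⟨γ, hγ, u, rfl⟩).symm⟩
    have hq : Topology.IsQuotientMap (toXQuot (SOZ Q)) := isQuotientMap_quot_mk
    rw [← hq.isOpen_preimage, hpre]
    refine isOpen_biUnion fun γ _ => isOpen_iUnion fun u => hU.preimage ?_
    unfold tmul
    fun_prop

/-- The action of the translations of `G̃` on the quotient is jointly continuous. -/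
theorem continuous_actTG_one {n : ℕ} (Q : (Fin n → ℝ) → ℝ) :
    Continuous fun p : (Fin n → ℝ) × XQuot n (SOZ Q) => actTG 1 p.1 p.2 := by
  have hq := (IsOpenQuotientMap.id (X := Fin n → ℝ)).prodMap (isOpenQuotientMap_toXQuot Q)
  refine hq.isQuotientMap.continuous_iff.2 ?_
  have h : Continuous fun p : (Fin n → ℝ) × (Matrix (Fin n) (Fin n) ℝ × (Fin n → ℝ)) =>
      ((1 : Matrix (Fin n) (Fin n) ℝ) * p.2.1, vecMul p.1 p.2.1 + p.2.2) := by
    fun_prop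
  exact (isOpenQuotientMap_toXQuot Q).continuous.comp h

theorem opNorm_nonneg {n : ℕ} (g : Matrix (Fin n) (Fin n) ℝ) : 0 ≤ opNorm g := norm_nonneg _

theorem opNorm_mul_le {n : ℕ} (g h : Matrix (Fin n) (Fin n) ℝ) :
    opNorm (g * h) ≤ opNorm g * opNorm h := by
  have heq : LinearMap.toContinuousLinearMap (Matrix.toEuclideanLin (g * h)) =
      (LinearMap.toContinuousLinearMap (Matrix.toEuclideanLin g)).comp
        (LinearMap.toContinuousLinearMap (Matrix.toEuclideanLin h)) := by
    ext v i
    simp [Matrix.toEuclideanLin]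
  rw [opNorm, heq]
  exact ContinuousLinearMap.opNorm_comp_le _ _

theorem opNorm_one_le {n : ℕ} : opNorm (1 : Matrix (Fin n) (Fin n) ℝ) ≤ 1 := by
  refine ContinuousLinearMap.opNorm_le_bound _ zero_le_one fun v => ?_
  simp [Matrix.toEuclideanLin]

theorem continuous_opNorm {n : ℕ} : Continuous (opNorm (n := n)) := by
  have h : Continuous ((LinearMap.toContinuousLinearMap :
      (EuclideanSpace ℝ (Fin n) →ₗ[ℝ] EuclideanSpace ℝ (Fin n)) ≃ₗ[ℝ] _).toLinearMap ∘ₗ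
        (Matrix.toEuclideanLin (𝕜 := ℝ) (m := Fin n) (n := Fin n)).toLinearMap) :=
    LinearMap.continuous_of_finiteDimensional _
  exact continuous_norm.comp h

/-- For a `G`-invariant measure carried by `G̃/Γ̃`, the set of points lying over a ball around the
identity of `G` is not null. -/
theorem measure_image_opNorm_lt_ne_zero {n : ℕ} {Q : (Fin n → ℝ) → ℝ} {c : ℝ} (hc : 1 < c)
    {μX : Measure (XQuot n (SOZ Q))} [IsProbabilityMeasure μX]
    (hinv : ∀ g ∈ SOplus Q, ∀ w : Fin n → ℝ, MeasurePreserving (actTG g w) μX μX)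
    (hsupp : ∀ᵐ x ∂μX, ∃ h ∈ SOplus Q, ∃ β, x = toXQuot (SOZ Q) (h, β)) :
    μX {x | ∃ h ∈ SOplus Q, ∃ β, opNorm h < c ∧ x = toXQuot (SOZ Q) (h, β)} ≠ 0 := by
  intro hzero
  have : SecondCountableTopology (Matrix (Fin n) (Fin n) ℝ) :=
    inferInstanceAs (SecondCountableTopology (Fin n → Fin n → ℝ))
  set S := {x | ∃ h ∈ SOplus Q, ∃ β, opNorm h < c ∧ x = toXQuot (SOZ Q) (h, β)}
  obtain ⟨T, hTG, hTc, hT⟩ := TopologicalSpace.countable_cover_nhdsWithin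
    (s := SOplus Q) (f := fun g => {h | opNorm (g⁻¹ * h) < c}) (by
      intro g hg
      refine mem_nhdsWithin_of_mem_nhds (IsOpen.mem_nhds ?_ ?_)
      · exact isOpen_lt (continuous_opNorm.comp (by fun_prop)) continuous_const
      · rw [Set.mem_ofPred_eq, Matrix.nonsing_inv_mul _ (isUnit_det_of_mem_SOplus hg)]
        exact opNorm_one_le.trans_lt hc)
  have hnull : ∀ᵐ x ∂μX, ∀ g ∈ T, actTG g⁻¹ 0 x ∉ S := by
    refine (ae_ball_iff hTc).2 fun g hg => ?_
    have := (hinv g⁻¹ (SOplus_inv_mem (hTG hg)) 0).quasiMeasurePreserving.preimage_null hzero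
    exact measure_eq_zero_iff_ae_notMem.1 this
  obtain ⟨x, hx, h, hh, β, rfl⟩ := (hnull.and hsupp).exists
  obtain ⟨g, hg, hgh⟩ := Set.mem_iUnion₂.1 (hT hh)
  refine hx g hg ⟨g⁻¹ * h, SOplus_mul_mem (SOplus_inv_mem (hTG hg)) hh, vecMul 0 h + β, hgh, rfl⟩

/-- A property holding at almost every point of the quotient holds, for almost every point `x`, at
almost every translate of `x`. -/
theorem ae_ae_actTG_one {n : ℕ} {Q : (Fin n → ℝ) → ℝ}
    {μX : Measure (XQuot n (SOZ Q))} [IsProbabilityMeasure μX]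
    (hinv : ∀ w : Fin n → ℝ, MeasurePreserving (actTG 1 w) μX μX)
    {P : XQuot n (SOZ Q) → Prop} (hP : ∀ᵐ x ∂μX, P x) :
    ∀ᵐ x ∂μX, ∀ᵐ w ∂(volume : Measure (Fin n → ℝ)), P (actTG 1 w x) := by
  set N := toMeasurable μX {x | ¬ P x} with hN
  have hNnull : μX N = 0 := by rw [hN, measure_toMeasurable]; exact hP
  have hmeas : MeasurableSet {p : (Fin n → ℝ) × XQuot n (SOZ Q) | actTG 1 p.1 p.2 ∉ N} :=
    (continuous_actTG_one Q).measurable (measurableSet_toMeasurable _ _).compl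
  have h : ∀ᵐ w ∂(volume : Measure (Fin n → ℝ)), ∀ᵐ x ∂μX, actTG 1 w x ∉ N :=
    ae_of_all _ fun w => measure_eq_zero_iff_ae_notMem.1
      ((hinv w).quasiMeasurePreserving.preimage_null hNnull)
  filter_upwards [(Measure.ae_ae_comm (p := fun w x => actTG 1 w x ∉ N) hmeas).1 h] with x hx
  filter_upwards [hx] with w hw
  by_contra hPw
  exact hw (subset_toMeasurable _ _ hPw)

/-- An almost everywhere property may be tested after an invertible affine substitution. -/
theorem ae_of_ae_vecMul_add {n : ℕ} {h : Matrix (Fin n) (Fin n) ℝ} (hdet : IsUnit h.det)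
    (β : Fin n → ℝ) {P : (Fin n → ℝ) → Prop}
    (hP : ∀ᵐ w ∂(volume : Measure (Fin n → ℝ)), P (vecMul w h + β)) :
    ∀ᵐ α ∂(volume : Measure (Fin n → ℝ)), P α := by
  have hlin : LinearMap.det (Matrix.toLin' (h⁻¹)ᵀ) ≠ 0 := by
    rw [LinearMap.det_toLin', Matrix.det_transpose]
    exact (Matrix.isUnit_nonsing_inv_det h hdet).ne_zero
  have hnull : volume (Matrix.toLin' (h⁻¹)ᵀ ⁻¹' {w | ¬ P (vecMul w h + β)}) = 0 := by
    rw [Measure.addHaar_preimage_linearMap _ hlin, show volume {w | ¬ P (vecMul w h + β)} = 0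
      from hP, mul_zero]
  have hnull' := (measurePreserving_sub_right (volume : Measure (Fin n → ℝ)) β)
    |>.quasiMeasurePreserving.preimage_null hnull
  refine measure_mono_null (fun α hα => ?_) hnull'
  have heq : vecMul (Matrix.toLin' (h⁻¹)ᵀ (α - β)) h + β = α := by
    rw [Matrix.toLin'_apply, Matrix.mulVec_transpose, Matrix.vecMul_vecMul,
      Matrix.nonsing_inv_mul _ hdet, Matrix.vecMul_one, sub_add_cancel]
  change ¬ P _
  rwa [heq]

/-- If the `G`-orbit of `[(h, α)]` hits `B_t` within `G_t`, then the `Γ`-orbit of `α` hits `A_t`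
within the ball of radius `c ^ 2 * t`, as soon as `‖h‖_op ≤ c`. -/
theorem exists_SOZ_of_actG_mem_Bset {n : ℕ} {Q : (Fin n → ℝ) → ℝ}
    {F : Set (Matrix (Fin n) (Fin n) ℝ)} {c t : ℝ} {A Atil : ℝ → Set (Fin n → ℝ)}
    (hAtilproj : ∀ x, x ∈ A t ↔ ∃ u : Fin n → ℤ, x + (fun i => (u i : ℝ)) ∈ Atil t)
    {h g : Matrix (Fin n) (Fin n) ℝ} (hh : h ∈ SOplus Q) (hhc : opNorm h ≤ c)
    (hg : g ∈ GballQ Q t) {α : Fin n → ℝ}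
    (hit : actG g⁻¹ (toXQuot (SOZ Q) (h, α)) ∈ Bset (SOZ Q) F c Atil t) :
    ∃ γ ∈ SOZ Q, mnorm γ ≤ c ^ 2 * t ∧ vecMul α γ ∈ A t := by
  obtain ⟨f, α', -, hfc, hα', heq⟩ := hit
  obtain ⟨γ, hγ, u, hu⟩ := mk_latRel_eq_iff.1 heq
  simp only [tmul, Prod.mk.injEq, Matrix.zero_vecMul, zero_add] at hu
  obtain ⟨rfl, rfl⟩ := hu
  refine ⟨γ, hγ, ?_, (hAtilproj _).2 ⟨u, hα'⟩⟩
  have hginv := isUnit_det_of_mem_SOplus (SOplus_inv_mem hg.1)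
  have hγinv : γ⁻¹ = (g⁻¹ * h * γ)⁻¹ * (g⁻¹ * h) := by
    rw [Matrix.mul_inv_rev, Matrix.mul_assoc, Matrix.nonsing_inv_mul _ (by
      rw [Matrix.det_mul]
      exact hginv.mul (isUnit_det_of_mem_SOplus hh)), Matrix.mul_one]
  have hgt : opNorm g⁻¹ ≤ t := hg.2
  have hc : 0 ≤ c := (opNorm_nonneg h).trans hhc
  calc mnorm γ = opNorm ((g⁻¹ * h * γ)⁻¹ * (g⁻¹ * h)) := by rw [mnorm, hγinv]
    _ ≤ opNorm (g⁻¹ * h * γ)⁻¹ * opNorm (g⁻¹ * h) := opNorm_mul_le _ _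
    _ ≤ c * (t * c) := by
      refine mul_le_mul hfc ((opNorm_mul_le _ _).trans ?_) (opNorm_nonneg _) hc
      exact mul_le_mul hgt hhc (opNorm_nonneg _) ((opNorm_nonneg _).trans hgt)
    _ = c ^ 2 * t := by ring

/-- **Lemma 3.2**: reduction of the torus shrinking target problem for the `Γ`-action to a
shrinking target problem for the `G`-action on `G̃/Γ̃`.  Subsets of `𝕋ⁿ` are modelled by
`ℤⁿ`-periodic subsets of `ℝⁿ`, and `m_{G̃}` is modelled by any `G̃`-invariant Borel
probability measure `μX` on the quotient. -/
theorem reduction_to_G_action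
    {n p q : ℕ} (hn3 : 3 ≤ n) (hp : 1 ≤ p) (hq : 1 ≤ q)
    (Q : (Fin n → ℝ) → ℝ) (hQ : IsNondegQuadForm Q) (hsig : HasSignature Q p q)
    (hrat : IsRationalForm Q)
    (A : ℝ → Set (Fin n → ℝ))
    (hAmeas : ∀ t, MeasurableSet (A t))
    (hAper : ∀ t, ∀ u : Fin n → ℤ, ∀ x, x ∈ A t ↔ x + (fun i => (u i : ℝ)) ∈ A t)
    (hAmono : ∀ s t : ℝ, s ≤ t → A t ⊆ A s)
    (hApos : ∀ t : ℝ, 0 < t → 0 < volume (A t ∩ unitCube n))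
    (hA0 : Tendsto (fun t => volume (A t ∩ unitCube n)) atTop (nhds 0))
    (Atil : ℝ → Set (Fin n → ℝ)) (hAtilcube : ∀ t, Atil t ⊆ unitCube n)
    (hAtilproj : ∀ t, ∀ x, x ∈ A t ↔ ∃ u : Fin n → ℤ, x + (fun i => (u i : ℝ)) ∈ Atil t)
    (F : Set (Matrix (Fin n) (Fin n) ℝ)) (hF : IsFundDom (SOplus Q) (SOZ Q) F)
    (c : ℝ) (hc : 1 < c)
    (μX : Measure (XQuot n (SOZ Q))) (hprob : IsProbabilityMeasure μX)
    (hinv : ∀ g ∈ SOplus Q, ∀ w : Fin n → ℝ, MeasurePreserving (actTG g w) μX μX)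
    (hhit : ∀ᵐ x ∂μX, ∃ t₀ : ℝ, ∀ t ≥ t₀, ∃ g ∈ GballQ Q t,
      actG g⁻¹ x ∈ Bset (SOZ Q) F c Atil t) :
    ∀ᵐ α ∂(volume : Measure (Fin n → ℝ)), ∃ t₀ : ℝ, ∀ t ≥ t₀,
      ∃ γ ∈ SOZ Q, mnorm γ ≤ c ^ 2 * t ∧ vecMul α γ ∈ A t := by
  have hsupp : ∀ᵐ x ∂μX, ∃ h ∈ SOplus Q, ∃ β, x = toXQuot (SOZ Q) (h, β) := by
    filter_upwards [hhit] with x hx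
    obtain ⟨t₀, ht₀⟩ := hx
    obtain ⟨g, hg, f, α, hf, -, -, hx⟩ := ht₀ t₀ le_rfl
    obtain ⟨⟨h, β⟩, rfl⟩ := Quot.mk_surjective x
    obtain ⟨γ, hγ, u, hu⟩ := mk_latRel_eq_iff.1 hx
    have hfγ : f = g⁻¹ * h * γ := congrArg Prod.fst hu
    refine ⟨h, ?_, β, rfl⟩
    have heq : h = g * (f * γ⁻¹) := by
      rw [hfγ, Matrix.mul_nonsing_inv_cancel_right _ _ (isUnit_det_of_mem_SOplus hγ.1),
        Matrix.mul_nonsing_inv_cancel_left _ _ (isUnit_det_of_mem_SOplus hg.1)]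
    rw [heq]
    exact SOplus_mul_mem hg.1 (SOplus_mul_mem (hF.1 hf) (SOplus_inv_mem hγ.1))
  have hpos := measure_image_opNorm_lt_ne_zero hc hinv hsupp
  have hfib := ae_ae_actTG_one (hinv 1 (one_mem_SOplus Q)) hhit
  obtain ⟨x, ⟨h, hh, β, hhc, rfl⟩, hx⟩ :=
    ((frequently_ae_mem_iff.2 hpos).and_eventually hfib).exists
  refine ae_of_ae_vecMul_add (isUnit_det_of_mem_SOplus hh) β ?_
  filter_upwards [hx] with w hw
  obtain ⟨t₀, ht₀⟩ := hw
  refine ⟨t₀, fun t ht => ?_⟩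
  obtain ⟨g, hg, hit⟩ := ht₀ t ht
  have hact : actTG 1 w (toXQuot (SOZ Q) (h, β)) = toXQuot (SOZ Q) (h, vecMul w h + β) := by
    change toXQuot (SOZ Q) (1 * h, vecMul w h + β) = _
    rw [one_mul]
  rw [hact] at hit
  exact exists_SOZ_of_actG_mem_Bset (hAtilproj t) hh hhc.le hg hit
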